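/- Let t ≥ 6 be an integer, α the real Salem root of x^4 - t x^3 + t x^2 - t x + 1, and λ = 1/√((t-4)t+8). Then the sequence θ_n = E(λ α^n) (nearest integer) is a divisibility sequence: d | n implies E(λ α^d) | E(λ α^n). -/

import Mathlib

/-- If `x` and `y` are the two roots of `X ^ 2 - p * X + q`, then two sequences satisfying the
Dickson recurrence with parameters `x` and `y` have the same integral coordinates with respect
to `1, x` and `1, y`. -/
theorem exists_int_coords_of_dickson_recurrence {p q : ℤ} {x y : ℝ} (f g : ℕ → ℝ)
    (hadd : x + y = p) (hmul : x * y = q)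
    (hf0 : f 0 = 2) (hf1 : f 1 = x) (hf : ∀ k, f (k + 2) = x * f (k + 1) - f k)
    (hg0 : g 0 = 2) (hg1 : g 1 = y) (hg : ∀ k, g (k + 2) = y * g (k + 1) - g k) (k : ℕ) :
    ∃ a b : ℤ, f k = a + b * x ∧ g k = a + b * y := by
  induction k using Nat.twoStepInduction with
  | zero => exact ⟨2, 0, by simp [hf0], by simp [hg0]⟩
  | one => exact ⟨0, 1, by simp [hf1], by simp [hg1]⟩
  | more k ih₀ ih₁ =>
    obtain ⟨a, b, hfa, hga⟩ := ih₀
    obtain ⟨c, d, hfc, hgc⟩ := ih₁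
    refine ⟨-d * q - a, c + d * p - b, ?_, ?_⟩
    · rw [hf, hfa, hfc]
      push_cast
      rw [← hadd, ← hmul]
      ring
    · rw [hg, hga, hgc]
      push_cast
      rw [← hadd, ← hmul]
      ring

theorem pow_add_inv_pow_recurrence {z : ℝ} (hz : z ≠ 0) (d k : ℕ) :
    z ^ (d * (k + 2)) + (z ^ (d * (k + 2)))⁻¹ =
      (z ^ d + (z ^ d)⁻¹) * (z ^ (d * (k + 1)) + (z ^ (d * (k + 1)))⁻¹) -
        (z ^ (d * k) + (z ^ (d * k))⁻¹) := by
  have h : z ^ d ≠ 0 := pow_ne_zero d hz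
  simp only [pow_mul]
  generalize z ^ d = w at h ⊢
  field_simp
  ring

theorem two_mul_cos_recurrence (φ : ℝ) (d k : ℕ) :
    2 * Real.cos ((d * (k + 2) : ℕ) * φ) =
      2 * Real.cos (d * φ) * (2 * Real.cos ((d * (k + 1) : ℕ) * φ)) -
        2 * Real.cos ((d * k : ℕ) * φ) := by
  have h₂ : ((d * (k + 2) : ℕ) : ℝ) * φ = (d * (k + 1) : ℕ) * φ + d * φ := by push_cast; ring
  have h₀ : ((d * k : ℕ) : ℝ) * φ = (d * (k + 1) : ℕ) * φ - d * φ := by push_cast; ring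
  rw [h₂, h₀, Real.cos_add, Real.cos_sub]
  ring

/-- The divisibility sequence attached to `z + z⁻¹` and `2 * cos φ`, when these are the two roots
of a monic integral quadratic polynomial. -/
theorem exists_int_divisibility_sequence {p q : ℤ} {z φ : ℝ} (hz : z ≠ 0)
    (hadd : z + z⁻¹ + 2 * Real.cos φ = p) (hmul : (z + z⁻¹) * (2 * Real.cos φ) = q)
    (hne : z + z⁻¹ - 2 * Real.cos φ ≠ 0) :
    ∃ θ : ℕ → ℤ,
      (∀ n : ℕ, z ^ n + (z ^ n)⁻¹ - 2 * Real.cos (n * φ) =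
        θ n * (z + z⁻¹ - 2 * Real.cos φ)) ∧
      ∀ d n : ℕ, d ∣ n → θ d ∣ θ n := by
  have coords : ∀ n : ℕ, ∃ a b : ℤ, z ^ n + (z ^ n)⁻¹ = a + b * (z + z⁻¹) ∧
      2 * Real.cos (n * φ) = a + b * (2 * Real.cos φ) := by
    refine exists_int_coords_of_dickson_recurrence (fun n => z ^ n + (z ^ n)⁻¹)
      (fun n => 2 * Real.cos (n * φ)) hadd hmul (by norm_num) (by simp) (fun k => ?_)
      (by simp) (by simp) (fun k => ?_)
    · simpa using pow_add_inv_pow_recurrence hz 1 k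
    · simpa using two_mul_cos_recurrence φ 1 k
  choose a θ hz_coords hcos using coords
  have hθ : ∀ n : ℕ, z ^ n + (z ^ n)⁻¹ - 2 * Real.cos (n * φ) =
      θ n * (z + z⁻¹ - 2 * Real.cos φ) := fun n => by
    rw [hz_coords, hcos]
    ring
  refine ⟨θ, hθ, ?_⟩
  rintro d _ ⟨k, rfl⟩
  obtain ⟨u, v, hu, hv⟩ := exists_int_coords_of_dickson_recurrence
    (p := 2 * a d + θ d * p) (q := a d ^ 2 + a d * θ d * p + θ d ^ 2 * q)
    (x := z ^ d + (z ^ d)⁻¹) (y := 2 * Real.cos (d * φ))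
    (fun k => z ^ (d * k) + (z ^ (d * k))⁻¹) (fun k => 2 * Real.cos ((d * k : ℕ) * φ))
    (by rw [hz_coords, hcos]; push_cast; rw [← hadd]; ring)
    (by rw [hz_coords, hcos]; push_cast; rw [← hadd, ← hmul]; ring)
    (by norm_num) (by simp) (pow_add_inv_pow_recurrence hz d)
    (by simp) (by simp) (two_mul_cos_recurrence φ d) k
  refine ⟨v, ?_⟩
  have h : (θ (d * k) : ℝ) * (z + z⁻¹ - 2 * Real.cos φ) =
      (θ d * v : ℝ) * (z + z⁻¹ - 2 * Real.cos φ) := by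
    rw [← hθ, mul_right_comm, ← hθ]
    rw [hu, hv]
    ring
  exact_mod_cast mul_right_cancel₀ hne h

theorem round_eq_of_abs_sub_lt {x : ℝ} {m : ℤ} (h : |x - m| < 1 / 2) : round x = m := by
  rw [abs_lt] at h
  rw [round_eq, Int.floor_eq_iff]
  constructor <;> linarith

theorem salem_nearest_integer_divisibility_sequence
    (t : ℤ) (ht : 6 ≤ t) (α : ℝ) (hα : 1 < α)
    (hroot : α ^ 4 - (t : ℝ) * α ^ 3 + (t : ℝ) * α ^ 2 - (t : ℝ) * α + 1 = 0)
    (lam : ℝ) (hlam : lam = 1 / Real.sqrt (((t : ℝ) - 4) * (t : ℝ) + 8)) :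
    ∀ d n : ℕ, d ∣ n → round (lam * α ^ d) ∣ round (lam * α ^ n) := by
  have htR : (6 : ℝ) ≤ t := by exact_mod_cast ht
  have hα0 : 0 < α := by linarith
  obtain ⟨s, hs⟩ : ∃ s, s = α + α⁻¹ := ⟨_, rfl⟩
  have hquad : s * (t - s) = t - 2 := by
    rw [hs]
    field_simp
    linear_combination -hroot
  have hs2 : 2 < s := by
    have h : s - 2 = (α - 1) ^ 2 * α⁻¹ := by
      rw [hs]
      field_simp
      ring
    have : 0 < (α - 1) ^ 2 * α⁻¹ := mul_pos (pow_pos (by linarith) 2) (inv_pos.mpr hα0)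
    linarith
  have hr0 : 0 < t - s := by
    by_contra! h
    nlinarith
  have hr2 : t - s < 2 := by
    by_contra! h
    nlinarith
  have hsqrt : Real.sqrt (((t : ℝ) - 4) * t + 8) = s - (t - s) := by
    rw [Real.sqrt_eq_iff_mul_self_eq_of_pos (by linarith)]
    nlinarith
  have hD : (447 / 100 : ℝ) < s - (t - s) := by
    rw [← hsqrt]
    exact Real.lt_sqrt_of_sq_lt (by nlinarith)
  have hα5 : 5 < α := by
    by_contra! h
    have h' : (α - 5) * (α - 1 / 5) ≤ 0 :=
      mul_nonpos_of_nonpos_of_nonneg (by linarith) (by linarith)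
    have hsα : s * α = α ^ 2 + 1 := by
      rw [hs]
      field_simp
    nlinarith
  have hcos : 2 * Real.cos (Real.arccos ((t - s) / 2)) = t - s := by
    rw [Real.cos_arccos (by linarith) (by linarith)]
    ring
  obtain ⟨θ, hθ, hdvd⟩ := exists_int_divisibility_sequence (p := t) (q := t - 2)
    (φ := Real.arccos ((t - s) / 2)) hα0.ne' (by rw [hcos, ← hs]; ring)
    (by rw [hcos, ← hs, hquad]; push_cast; ring) (by rw [hcos, ← hs]; linarith)
  have hround : ∀ n : ℕ, round (lam * α ^ n) = θ n := by
    intro n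
    apply round_eq_of_abs_sub_lt
    have hθn := hθ n
    rw [hcos, ← hs] at hθn
    have hdiff : lam * α ^ n - θ n =
        (2 * Real.cos (n * Real.arccos ((t - s) / 2)) - (α ^ n)⁻¹) / (s - (t - s)) := by
      rw [hlam, hsqrt, eq_div_iff (by linarith), sub_mul, ← hθn]
      have : s - (t - s) ≠ 0 := by linarith
      field_simp
      ring
    have hnum : |2 * Real.cos (n * Real.arccos ((t - s) / 2)) - (α ^ n)⁻¹| ≤ 11 / 5 := by
      rcases Nat.eq_zero_or_pos n with rfl | hn
      · norm_num
      · have hpow : 5 ≤ α ^ n := hα5.le.trans (le_self_pow₀ hα.le hn.ne')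
        have hinv : (α ^ n)⁻¹ ≤ 1 / 5 := by
          rw [one_div]
          exact inv_anti₀ (by norm_num) hpow
        have hinv0 : 0 < (α ^ n)⁻¹ := by positivity
        have h₁ := Real.neg_one_le_cos (n * Real.arccos ((t - s) / 2))
        have h₂ := Real.cos_le_one (n * Real.arccos ((t - s) / 2))
        rw [abs_le]
        constructor <;> linarith
    rw [hdiff, abs_div, abs_of_pos (by linarith : 0 < s - (t - s)), div_lt_iff₀ (by linarith)]
    linarith
  intro d n hdn
  rw [hround, hround]
  exact hdvd d n hdn
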